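/- arXiv:1811.02437 — 2 statements merged into one kernel-verified Lean document; each statement's English description precedes it below -/
import Mathlib

section
/- Let n ≥ 2p and let α_i, β_i be the operators on V^⊗n defined in the context. For all 1 ≤ i ≤ n−2p+1, one has α_{i+1}∘∩_i = α_i∘∩_{i+2p−2} and β_{i+1}∘∩_i = β_i∘∩_{i+2p−2} as maps V^⊗(n−2) → V^⊗n, and ∪_i∘α_{i+1} = ∪_{i+2p−2}∘α_i and ∪_i∘β_{i+1} = ∪_{i+2p−2}∘β_i as maps V^⊗n → V^⊗(n−2). -/
noncomputable section

/-- The quantum integer `[n] = (q^n - q^{-n})/(q - q⁻¹)`. -/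
def qint (q : ℂ) (n : ℤ) : ℂ := (q ^ n - q ^ (-n)) / (q - q⁻¹)

/-- The quantum factorial `[n]! = [1][2]⋯[n]`, with `[0]! = 1`. -/
def qfact (q : ℂ) (n : ℕ) : ℂ := ∏ m ∈ Finset.range n, qint q ((m : ℤ) + 1)

/-- Binary strings of length `z`, indexing the standard basis of `V^{⊗z}` for `V = ℂ²`:
value `1` at a position means `ν₁` there, value `0` means `ν₀`. -/
abbrev Str (z : ℕ) := Fin z → Fin 2

/-- `V^{⊗z}`, modelled by coordinates with respect to the standard basis of tensors of
`ν₀`'s and `ν₁`'s. -/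
abbrev Vz (z : ℕ) := Str z → ℂ

/-- The basis vector `ρ_{i₁,…,i_k,z}` of `V^{⊗z}` having `ν₁` exactly at the positions in `S`
and `ν₀` elsewhere. -/
def rho (z : ℕ) (S : Finset (Fin z)) : Vz z :=
  fun t => if t = (fun j => if j ∈ S then 1 else 0) then 1 else 0

/-- `x_{0,z} = ν₀^{⊗z}`. -/
def x0 (z : ℕ) : Vz z := rho z ∅

/-- `x_{z,z} = ν₁^{⊗z}`. -/
def xtop (z : ℕ) : Vz z := rho z Finset.univ

/-- The set of positions of a basis string carrying `ν₁`. -/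
def onesOf {z : ℕ} (s : Str z) : Finset (Fin z) := Finset.univ.filter fun j => s j = 1

/-- `i₁ + ⋯ + i_k`, the sum of the (1-indexed) positions in `S`. -/
def posSum {z : ℕ} (S : Finset (Fin z)) : ℤ := ∑ j ∈ S, (((j : ℕ) : ℤ) + 1)

/-- The `K`-weight exponent of a basis vector of `V`: `Kν₀ = qν₀`, `Kν₁ = q⁻¹ν₁`. -/
def kwt (v : Fin 2) : ℤ := if v = 0 then 1 else -1

/-- Matrix of `E_z = Σᵢ 1^{⊗(i-1)} ⊗ E ⊗ K^{⊗(z-i)}` on `V^{⊗z}`. -/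
def Emat (q : ℂ) (z : ℕ) : Matrix (Str z) (Str z) ℂ := fun t s =>
  ∑ i : Fin z,
    if s i = 1 ∧ t = Function.update s i 0 then
      q ^ (∑ j ∈ Finset.univ.filter (fun j => i < j), kwt (s j)) else 0

/-- Matrix of `F_z = Σᵢ (K⁻¹)^{⊗(i-1)} ⊗ F ⊗ 1^{⊗(z-i)}` on `V^{⊗z}`. -/
def Fmat (q : ℂ) (z : ℕ) : Matrix (Str z) (Str z) ℂ := fun t s =>
  ∑ i : Fin z,
    if s i = 0 ∧ t = Function.update s i 1 then
      q ^ (-∑ j ∈ Finset.univ.filter (fun j => j < i), kwt (s j)) else 0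

/-- `E_z` as a linear operator on `V^{⊗z}`. -/
def EOp (q : ℂ) (z : ℕ) : Module.End ℂ (Vz z) := (Emat q z).mulVecLin

/-- `F_z` as a linear operator on `V^{⊗z}`. -/
def FOp (q : ℂ) (z : ℕ) : Module.End ℂ (Vz z) := (Fmat q z).mulVecLin

/-- Matrix of the map `α : V^{⊗(2p-1)} → V^{⊗(2p-1)}`, with
`α(ρ_{i₁,…,i_k,2p-1}) = q^{k(2p-1) - (k²-k)/2 - Σᵢ iⱼ}·[k]!·E_{2p-1}^{p-k-1} x_{2p-1,2p-1}`
for `k ≤ p-1`, and `α(ρ_{i₁,…,i_k,2p-1}) = 0` for `k ≥ p`. -/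
def alphaMat (q : ℂ) (p : ℕ) : Matrix (Str (2 * p - 1)) (Str (2 * p - 1)) ℂ := fun t s =>
  let k := (onesOf s).card
  if k < p then
    (q ^ ((k : ℤ) * ((2 * p - 1 : ℕ) : ℤ) - ((k : ℤ) ^ 2 - (k : ℤ)) / 2 - posSum (onesOf s))
        * qfact q k)
      * ((EOp q (2 * p - 1) ^ (p - 1 - k)) (xtop (2 * p - 1)) t)
  else 0

/-- Matrix of the map `β : V^{⊗(2p-1)} → V^{⊗(2p-1)}`, with
`β(ρ_{i₁,…,i_k,2p-1}) = q^{k(2p-1) - (k²-k)/2 - Σᵢ iⱼ}·[2p-1-k]!·F_{2p-1}^{k-p} x_{0,2p-1}`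
for `k ≥ p`, and `β(ρ_{i₁,…,i_k,2p-1}) = 0` for `k ≤ p-1`. -/
def betaMat (q : ℂ) (p : ℕ) : Matrix (Str (2 * p - 1)) (Str (2 * p - 1)) ℂ := fun t s =>
  let k := (onesOf s).card
  if p ≤ k then
    (q ^ ((k : ℤ) * ((2 * p - 1 : ℕ) : ℤ) - ((k : ℤ) ^ 2 - (k : ℤ)) / 2 - posSum (onesOf s))
        * qfact q (2 * p - 1 - k))
      * ((FOp q (2 * p - 1) ^ (k - p)) (x0 (2 * p - 1)) t)
  else 0

/-- The operator `α` on `V^{⊗(2p-1)}`. -/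
def alphaOp (q : ℂ) (p : ℕ) : Module.End ℂ (Vz (2 * p - 1)) := (alphaMat q p).mulVecLin

/-- The operator `β` on `V^{⊗(2p-1)}`. -/
def betaOp (q : ℂ) (p : ℕ) : Module.End ℂ (Vz (2 * p - 1)) := (betaMat q p).mulVecLin

/-- `1^{⊗a} ⊗ M ⊗ 1^{⊗(n-a-c)}`: the amplification of a matrix `M` acting on `c` tensor
factors to `V^{⊗n}`, placed on the factor positions `a+1, …, a+c` (1-indexed). -/
def ampMat (n a c : ℕ) (h : a + c ≤ n) (M : Matrix (Str c) (Str c) ℂ) :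
    Matrix (Str n) (Str n) ℂ := fun t s =>
  if ∀ j : Fin n, ((j : ℕ) < a ∨ a + c ≤ (j : ℕ)) → t j = s j then
    M (fun j => t ⟨a + (j : ℕ), by have := j.isLt; omega⟩)
      (fun j => s ⟨a + (j : ℕ), by have := j.isLt; omega⟩)
  else 0

/-- `α_i = 1^{⊗(i-1)} ⊗ α ⊗ 1^{⊗(n-2p+2-i)}` on `V^{⊗n}` (with `i` 1-indexed). -/
def alphaOpAt (q : ℂ) (p n i : ℕ) (h : (i - 1) + (2 * p - 1) ≤ n) : Module.End ℂ (Vz n) :=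
  (ampMat n (i - 1) (2 * p - 1) h (alphaMat q p)).mulVecLin

/-- `β_i = 1^{⊗(i-1)} ⊗ β ⊗ 1^{⊗(n-2p+2-i)}` on `V^{⊗n}` (with `i` 1-indexed). -/
def betaOpAt (q : ℂ) (p n i : ℕ) (h : (i - 1) + (2 * p - 1) ≤ n) : Module.End ℂ (Vz n) :=
  (ampMat n (i - 1) (2 * p - 1) h (betaMat q p)).mulVecLin

/-- Matrix of `∪` applied at the (0-indexed) positions `i, i+1` of `N = M + 2` strands:
`∪(ν₀⊗ν₀) = ∪(ν₁⊗ν₁) = 0`, `∪(ν₁⊗ν₀) = 1`, `∪(ν₀⊗ν₁) = -q`. -/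
def cupMat (q : ℂ) (N M i : ℕ) (h : N = M + 2) (hi : i + 1 < N) :
    Matrix (Str M) (Str N) ℂ := fun t s =>
  if ∀ j : Fin M,
      t j = s ⟨if (j : ℕ) < i then (j : ℕ) else (j : ℕ) + 2, by
        have := j.isLt; split <;> omega⟩ then
    (if s ⟨i, by omega⟩ = 1 ∧ s ⟨i + 1, hi⟩ = 0 then 1
     else if s ⟨i, by omega⟩ = 0 ∧ s ⟨i + 1, hi⟩ = 1 then -q
     else 0)
  else 0

/-- Matrix of `∩` inserted at the (0-indexed) positions `i, i+1` of `N = M + 2` strands: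
`∩(1) = q⁻¹ ν₁⊗ν₀ - ν₀⊗ν₁`. -/
def capMat (q : ℂ) (N M i : ℕ) (h : N = M + 2) (hi : i + 1 < N) :
    Matrix (Str N) (Str M) ℂ := fun t s =>
  if ∀ j : Fin M,
      s j = t ⟨if (j : ℕ) < i then (j : ℕ) else (j : ℕ) + 2, by
        have := j.isLt; split <;> omega⟩ then
    (if t ⟨i, by omega⟩ = 1 ∧ t ⟨i + 1, hi⟩ = 0 then q⁻¹
     else if t ⟨i, by omega⟩ = 0 ∧ t ⟨i + 1, hi⟩ = 1 then -1
     else 0)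
  else 0

/-- `∪_{i+1} : V^{⊗N} → V^{⊗M}`, `N = M + 2` (here `i` is the 0-indexed position). -/
def cupOp (q : ℂ) (N M i : ℕ) (h : N = M + 2) (hi : i + 1 < N) : Vz N →ₗ[ℂ] Vz M :=
  (cupMat q N M i h hi).mulVecLin

/-- `∩_{i+1} : V^{⊗M} → V^{⊗N}`, `N = M + 2` (here `i` is the 0-indexed position). -/
def capOp (q : ℂ) (N M i : ℕ) (h : N = M + 2) (hi : i + 1 < N) : Vz M →ₗ[ℂ] Vz N :=
  (capMat q N M i h hi).mulVecLin

/-- Matrix of the Jones–Wenzl-type map `G_n` on `V^{⊗n}`: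
`G_n(ρ_{i₁,…,i_k,n}) = q^{kn - (k²-k)/2 - Σ iⱼ}·([n-k]!/[n]!)·F_n^k x_{0,n}`. -/
def jwMat (q : ℂ) (n : ℕ) : Matrix (Str n) (Str n) ℂ := fun t s =>
  let k := (onesOf s).card
  (q ^ ((k : ℤ) * (n : ℤ) - ((k : ℤ) ^ 2 - (k : ℤ)) / 2 - posSum (onesOf s))
      * (qfact q (n - k) / qfact q n))
    * ((FOp q n ^ k) (x0 n) t)

/-- The Jones–Wenzl-type map `G_n` on `V^{⊗n}`. -/
def jwOp (q : ℂ) (n : ℕ) : Module.End ℂ (Vz n) := (jwMat q n).mulVecLin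

/-- `v ⊗ ν_a : V^{⊗z} ⊗ V → V^{⊗(z+1)}` (appending a basis vector of `V` on the right). -/
def appendR {z : ℕ} (v : Vz z) (a : Fin 2) : Vz (z + 1) :=
  fun t => if t (Fin.last z) = a then v (fun j => t j.castSucc) else 0

/-- `ν_a ⊗ v : V ⊗ V^{⊗z} → V^{⊗(z+1)}` (appending a basis vector of `V` on the left). -/
def appendL {z : ℕ} (a : Fin 2) (v : Vz z) : Vz (z + 1) :=
  fun t => if t 0 = a then v (fun j => t j.succ) else 0

/-- `ξ_{n,z} = Σ_{1 ≤ i₁ < ⋯ < i_n ≤ z} q^{-2(i₁+⋯+i_n)}`. -/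
def xiSum (q : ℂ) (n z : ℕ) : ℂ :=
  ∑ S ∈ Finset.powersetCard n (Finset.univ : Finset (Fin z)), q ^ (-2 * posSum S)

/-- The restriction of an infinite binary string to its first `c` entries. -/
def prefixStr (c : ℕ) (T : ℕ → Fin 2) : Str c := fun j => T j

/-- The number of ones among the first `c` entries. -/
def onesCount (c : ℕ) (T : ℕ → Fin 2) : ℤ := ∑ j ∈ Finset.range c, ((T j : ℕ) : ℤ)

/-- The sum of the (1-indexed) positions of the ones among the first `c` entries. -/
def onesPos (c : ℕ) (T : ℕ → Fin 2) : ℤ := ∑ j ∈ Finset.range c, ((j : ℤ) + 1) * ((T j : ℕ) : ℤ)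

/-- The string `x, S 0, S 1, …`. -/
def consStr (x : Fin 2) (S : ℕ → Fin 2) : ℕ → Fin 2 := fun j => if j = 0 then x else S (j - 1)

lemma prefixStr_surjective (c : ℕ) (t : Str c) : ∃ T, prefixStr c T = t :=
  ⟨fun j => if h : j < c then t ⟨j, h⟩ else 0, by ext j; simp [prefixStr]⟩

lemma onesCount_nonneg (c : ℕ) (T : ℕ → Fin 2) : 0 ≤ onesCount c T :=
  Finset.sum_nonneg fun j _ => by positivity

lemma onesCount_le (c : ℕ) (T : ℕ → Fin 2) : onesCount c T ≤ c := by
  have h := Finset.sum_le_card_nsmul (Finset.range c) (fun j => ((T j : ℕ) : ℤ)) 1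
    fun j _ => by have := (T j).isLt; omega
  simpa [onesCount] using h

lemma onesCount_succ (c : ℕ) (T : ℕ → Fin 2) :
    onesCount (c + 1) T = onesCount c T + ((T c : ℕ) : ℤ) :=
  Finset.sum_range_succ _ _

lemma onesPos_succ (c : ℕ) (T : ℕ → Fin 2) :
    onesPos (c + 1) T = onesPos c T + ((c : ℤ) + 1) * ((T c : ℕ) : ℤ) :=
  Finset.sum_range_succ _ _

lemma onesCount_succ' (c : ℕ) (T : ℕ → Fin 2) :
    onesCount (c + 1) T = onesCount c (fun j => T (j + 1)) + ((T 0 : ℕ) : ℤ) :=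
  Finset.sum_range_succ' _ _

lemma onesPos_succ' (c : ℕ) (T : ℕ → Fin 2) :
    onesPos (c + 1) T = onesPos c (fun j => T (j + 1)) + onesCount (c + 1) T := by
  rw [onesCount_succ', onesPos, Finset.sum_range_succ', onesPos, onesCount, ← add_assoc,
    ← Finset.sum_add_distrib]
  push_cast
  congr 1
  · exact Finset.sum_congr rfl fun j _ => by ring
  · ring

lemma onesCount_consStr (c : ℕ) (x : Fin 2) (S : ℕ → Fin 2) :
    onesCount (c + 1) (consStr x S) = onesCount c S + ((x : ℕ) : ℤ) := by
  simp [onesCount_succ', consStr]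

lemma onesPos_consStr (c : ℕ) (x : Fin 2) (S : ℕ → Fin 2) :
    onesPos (c + 1) (consStr x S) = onesPos c S + (onesCount c S + ((x : ℕ) : ℤ)) := by
  rw [onesPos_succ', onesCount_consStr]
  simp [consStr]

lemma onesCount_update (c : ℕ) (x : Fin 2) (S : ℕ → Fin 2) :
    onesCount (c + 1) (Function.update S c x) = onesCount c S + ((x : ℕ) : ℤ) := by
  rw [onesCount_succ, Function.update_self]
  congr 1
  refine Finset.sum_congr rfl fun j hj => ?_
  rw [Function.update_of_ne (Finset.mem_range.1 hj).ne]

lemma onesPos_update (c : ℕ) (x : Fin 2) (S : ℕ → Fin 2) :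
    onesPos (c + 1) (Function.update S c x) = onesPos c S + ((c : ℤ) + 1) * ((x : ℕ) : ℤ) := by
  rw [onesPos_succ, Function.update_self]
  congr 1
  refine Finset.sum_congr rfl fun j hj => ?_
  rw [Function.update_of_ne (Finset.mem_range.1 hj).ne]

/-- The matrix `M` on `V^{⊗c}` shifts the number of ones by `P`, and its entries depend on the
strings only through `C` and the sums of the positions of the ones. -/
def IsPosMatrix (q : ℂ) (c : ℕ) (P : ℤ) (C : ℤ → ℂ) (M : Matrix (Str c) (Str c) ℂ) : Prop :=
  ∀ T S, M (prefixStr c T) (prefixStr c S) =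
    if onesCount c T = onesCount c S + P then
      C (onesCount c S) * q ^ (-onesPos c S - onesPos c T) else 0

/-- The function `C` alternates on the range of numbers of ones relevant for shifts by `P`. -/
def AlternatesOn (c : ℕ) (P : ℤ) (C : ℤ → ℂ) : Prop :=
  ∀ k : ℤ, 0 ≤ k → k + 1 ≤ c → 1 ≤ k + 1 + P → k + 1 + P ≤ c → C (k + 1) = -C k

lemma zpow_of_add {q : ℂ} (hq : q ≠ 0) {P D : ℤ} (hP : q ^ P = -1) (hD : q ^ D = 1)
    {e e₀ r : ℤ} (x y : ℤ) (h : e = e₀ + x * P + y * D + r) :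
    q ^ e = q ^ e₀ * (-1) ^ x * q ^ r := by
  rw [h, zpow_add₀ hq, zpow_add₀ hq, zpow_add₀ hq, mul_comm x, zpow_mul, hP, mul_comm y, zpow_mul,
    hD, one_zpow, mul_one]

lemma IsPosMatrix.cap_slide {q : ℂ} (hq : q ≠ 0) {d : ℕ} {P : ℤ} {C : ℤ → ℂ}
    {M : Matrix (Str (d + 1)) (Str (d + 1)) ℂ} (hM : IsPosMatrix q (d + 1) P C M)
    (hP : q ^ P = -1) (hd : q ^ ((d : ℤ) + 2) = 1) (hC : AlternatesOn (d + 1) P C)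
    (T S : ℕ → Fin 2) :
    (if T 0 = 1 then q⁻¹ else -1) *
        M (prefixStr (d + 1) fun j => T (j + 1)) (prefixStr (d + 1) (consStr (1 - T 0) S)) =
      (if T (d + 1) = 1 then -1 else q⁻¹) *
        M (prefixStr (d + 1) T) (prefixStr (d + 1) (Function.update S d (1 - T (d + 1)))) := by
  rw [hM, hM, onesCount_consStr, onesPos_consStr, onesCount_update, onesPos_update]
  have h1 := onesCount_succ' (d + 1) T
  have h2 := onesCount_succ (d + 1) T
  have h3 := onesPos_succ' (d + 1) T
  have h4 := onesPos_succ (d + 1) T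
  have h5 := onesCount_succ d (fun j => T (j + 1))
  have h6 := onesCount_nonneg d (fun j => T (j + 1))
  have h7 := onesCount_le d (fun j => T (j + 1))
  have h8 := onesCount_nonneg d S
  have h9 := onesCount_le d S
  have hk := hC (onesCount d S) h8 (by push_cast; omega)
  push_cast at *
  generalize onesCount (d + 1) (fun j => T (j + 1)) = n1 at *
  generalize onesCount d (fun j => T (j + 1)) = n0 at *
  generalize onesCount (d + 1) T = n2 at *
  generalize onesPos (d + 1) (fun j => T (j + 1)) = p1 at *
  generalize onesPos (d + 1) T = p2 at *
  generalize onesCount d S = k at *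
  generalize onesPos d S = r at *
  obtain hx | hx : T 0 = 0 ∨ T 0 = 1 := by omega
  all_goals obtain hy | hy : T (d + 1) = 0 ∨ T (d + 1) = 1 := by omega
  all_goals
    simp only [hx, hy, Fin.isValue, Fin.val_zero, Fin.val_one, sub_zero, sub_self, zero_ne_one,
      if_true, if_false, Nat.cast_zero, Nat.cast_one, mul_zero, mul_one, add_zero] at *
  · by_cases hN : n1 = k + 1 + P
    · rw [if_pos hN, if_pos (by omega), zpow_of_add hq hP hd (e := -(r + (d + 1)) - p2)
        (e₀ := -(r + (k + 1)) - p1) (r := 1) (-1) (-1) (by omega)]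
      simp
      field_simp
    · rw [if_neg hN, if_neg (by omega)]
      simp
  · by_cases hN : n1 = k + 1 + P
    · rw [if_pos hN, if_pos (by omega), hk (by omega) (by omega),
        zpow_of_add hq hP hd (e := -r - p2)
        (e₀ := -(r + (k + 1)) - p1) (r := 0) (-1) 1 (by omega)]
      simp
    · rw [if_neg hN, if_neg (by omega)]
  · by_cases hN : n1 = k + P
    · rw [if_pos hN, if_pos (by omega), hk (by omega) (by omega),
        zpow_of_add hq hP hd (e := -(r + (d + 1)) - p2)
        (e₀ := -(r + k) - p1) (r := 0) (-1) (-1) (by omega)]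
      simp
    · rw [if_neg hN, if_neg (by omega)]
  · by_cases hN : n1 = k + P
    · rw [if_pos hN, if_pos (by omega), zpow_of_add hq hP hd (e := -r - p2)
        (e₀ := -(r + k) - p1) (r := -1) (-1) 1 (by omega)]
      simp
      field_simp
    · rw [if_neg hN, if_neg (by omega)]
      simp

lemma IsPosMatrix.cup_slide {q : ℂ} (hq : q ≠ 0) {d : ℕ} {P : ℤ} {C : ℤ → ℂ}
    {M : Matrix (Str (d + 1)) (Str (d + 1)) ℂ} (hM : IsPosMatrix q (d + 1) P C M)
    (hP : q ^ P = -1) (hd : q ^ ((d : ℤ) + 2) = 1) (hC : AlternatesOn (d + 1) P C)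
    (T S : ℕ → Fin 2) :
    (if S 0 = 1 then 1 else -q) *
        M (prefixStr (d + 1) (consStr (1 - S 0) T)) (prefixStr (d + 1) fun j => S (j + 1)) =
      (if S (d + 1) = 1 then -q else 1) *
        M (prefixStr (d + 1) (Function.update T d (1 - S (d + 1)))) (prefixStr (d + 1) S) := by
  rw [hM, hM, onesCount_consStr, onesPos_consStr, onesCount_update, onesPos_update]
  have h1 := onesCount_succ' (d + 1) S
  have h2 := onesCount_succ (d + 1) S
  have h3 := onesPos_succ' (d + 1) S
  have h4 := onesPos_succ (d + 1) S
  have h5 := onesCount_succ d (fun j => S (j + 1))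
  have h6 := onesCount_nonneg d (fun j => S (j + 1))
  have h7 := onesCount_le d (fun j => S (j + 1))
  have h8 := onesCount_nonneg d T
  have h9 := onesCount_le d T
  have hk := hC (onesCount d (fun j => S (j + 1))) h6 (by push_cast; omega)
  push_cast at *
  generalize onesCount (d + 1) (fun j => S (j + 1)) = n1 at *
  generalize onesCount d (fun j => S (j + 1)) = n0 at *
  generalize onesCount (d + 1) S = n2 at *
  generalize onesPos (d + 1) (fun j => S (j + 1)) = p1 at *
  generalize onesPos (d + 1) S = p2 at *
  generalize onesCount d T = k at *
  generalize onesPos d T = r at *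
  obtain hx | hx : S 0 = 0 ∨ S 0 = 1 := by omega
  all_goals obtain hy | hy : S (d + 1) = 0 ∨ S (d + 1) = 1 := by omega
  all_goals
    simp only [hx, hy, Fin.isValue, Fin.val_zero, Fin.val_one, sub_zero, sub_self, zero_ne_one,
      if_true, if_false, Nat.cast_zero, Nat.cast_one, mul_zero, mul_one, add_zero] at *
  · obtain rfl : n2 = n1 := by omega
    by_cases hN : k + 1 = n2 + P
    · rw [if_pos hN, if_pos (by omega), zpow_of_add hq hP hd (e := -p2 - (r + (d + 1)))
        (e₀ := -p1 - (r + (k + 1))) (r := 1) 1 (-1) (by omega)]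
      simp
      ring
    · rw [if_neg hN, if_neg (by omega)]
      simp
  · obtain rfl : n1 = n2 + 1 := by omega
    obtain rfl : n0 = n2 := by omega
    by_cases hN : k + 1 = n0 + 1 + P
    · rw [if_pos hN, if_pos (by omega), hk (by omega) (by omega),
        zpow_of_add hq hP hd (e := -p2 - r)
        (e₀ := -p1 - (r + (k + 1))) (r := 0) 1 1 (by omega)]
      simp
    · rw [if_neg hN, if_neg (by omega)]
  · obtain rfl : n2 = n1 + 1 := by omega
    obtain rfl : n0 = n1 := by omega
    by_cases hN : k = n0 + P
    · rw [if_pos hN, if_pos (by omega), hk (by omega) (by omega),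
        zpow_of_add hq hP hd (e := -p2 - (r + (d + 1)))
        (e₀ := -p1 - (r + k)) (r := 0) 1 (-1) (by omega)]
      simp
    · rw [if_neg hN, if_neg (by omega)]
  · obtain rfl : n2 = n1 := by omega
    by_cases hN : k = n2 + P
    · rw [if_pos hN, if_pos (by omega), zpow_of_add hq hP hd (e := -p2 - r)
        (e₀ := -p1 - (r + k)) (r := -1) 1 1 (by omega)]
      simp
      field_simp
    · rw [if_neg hN, if_neg (by omega)]
      simp

lemma ampMat_prefixStr {n a c : ℕ} (h : a + c ≤ n) (M : Matrix (Str c) (Str c) ℂ)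
    (T S : ℕ → Fin 2) :
    ampMat n a c h M (prefixStr n T) (prefixStr n S) =
      if ∀ j < n, j < a ∨ a + c ≤ j → T j = S j then
        M (prefixStr c fun j => T (a + j)) (prefixStr c fun j => S (a + j)) else 0 := by
  simp only [ampMat, prefixStr, Fin.forall_iff]
  rfl

lemma ampMat_transpose {n a c : ℕ} (h : a + c ≤ n) (M : Matrix (Str c) (Str c) ℂ) :
    (ampMat n a c h M).transpose = ampMat n a c h M.transpose := by
  ext t s
  simp only [ampMat, Matrix.transpose_apply, eq_comm]

/-- The matrix inserting the vector `∑ w x y ν_x ⊗ ν_y` at the (0-indexed) positions `i, i+1`. -/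
def insertMat (w : Fin 2 → Fin 2 → ℂ) (N M i : ℕ) (h : N = M + 2) (hi : i + 1 < N) :
    Matrix (Str N) (Str M) ℂ := fun t s =>
  if ∀ j : Fin M,
      s j = t ⟨if (j : ℕ) < i then (j : ℕ) else (j : ℕ) + 2, by
        have := j.isLt; split <;> omega⟩ then
    w (t ⟨i, by omega⟩) (t ⟨i + 1, hi⟩)
  else 0

lemma insertMat_prefixStr (w : Fin 2 → Fin 2 → ℂ) {N M i : ℕ} (h : N = M + 2) (hi : i + 1 < N)
    (T S : ℕ → Fin 2) :
    insertMat w N M i h hi (prefixStr N T) (prefixStr M S) =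
      if ∀ j < M, S j = T (if j < i then j else j + 2) then w (T i) (T (i + 1)) else 0 := by
  simp only [insertMat, prefixStr, Fin.forall_iff]

lemma mul_apply_eq_of_unique {l m : Type*} {n : ℕ} (A : Matrix l (Str n) ℂ)
    (B : Matrix (Str n) m ℂ) (t : l) (s : m) (U₀ : ℕ → Fin 2)
    (hU : ∀ U, A t (prefixStr n U) ≠ 0 → B (prefixStr n U) s ≠ 0 → ∀ j < n, U j = U₀ j) :
    (A * B) t s = A t (prefixStr n U₀) * B (prefixStr n U₀) s := by
  rw [Matrix.mul_apply]
  refine Finset.sum_eq_single _ (fun u _ hu => ?_) (by simp)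
  obtain ⟨U, rfl⟩ := prefixStr_surjective n u
  by_contra hne
  exact hu (funext fun j => hU U (left_ne_zero_of_mul hne) (right_ne_zero_of_mul hne) j j.isLt)

lemma prefixStr_congr {c : ℕ} {T S : ℕ → Fin 2} (h : ∀ j < c, T j = S j) :
    prefixStr c T = prefixStr c S :=
  funext fun j => h j j.isLt

lemma ampMat_mul_insertMat_left {w : Fin 2 → Fin 2 → ℂ} (hw : ∀ x, w x x = 0) {n m a d : ℕ}
    (hn : n = m + 2) (h : a + 1 + (d + 1) ≤ n) (ha : a + 1 < n)
    (M : Matrix (Str (d + 1)) (Str (d + 1)) ℂ) (T S : ℕ → Fin 2) :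
    (ampMat n (a + 1) (d + 1) h M * insertMat w n m a hn ha) (prefixStr n T) (prefixStr m S) =
      if ∀ j < m, (j < a → S j = T j) ∧ (a + d ≤ j → S j = T (j + 2)) then
        w (T a) (1 - T a) * M (prefixStr (d + 1) fun j => T (a + (j + 1)))
          (prefixStr (d + 1) (consStr (1 - T a) fun j => S (a + j))) else 0 := by
  generalize hx : 1 - T a = x
  obtain ⟨U₀, hU₀⟩ : ∃ U₀ : ℕ → Fin 2, ∀ j, U₀ j = if j ≤ a then T j else if j = a + 1 then x else
    if j < a + 1 + (d + 1) then S (j - 2) else T j := ⟨_, fun _ => rfl⟩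
  rw [mul_apply_eq_of_unique _ _ _ _ U₀]
  · rw [ampMat_prefixStr, insertMat_prefixStr, if_pos (fun j hj hj' => by grind -ring), mul_comm]
    have hcond : (∀ j < m, (j < a → S j = T j) ∧ (a + d ≤ j → S j = T (j + 2))) ↔
        ∀ j < m, S j = U₀ (if j < a then j else j + 2) :=
      forall₂_congr fun j hj => by grind -ring
    rw [← if_congr hcond rfl rfl, ite_mul, zero_mul,
      show U₀ a = T a by grind -ring, show U₀ (a + 1) = x by grind -ring]
    congr 3
    · exact prefixStr_congr fun j hj => by grind -ring
    · refine prefixStr_congr fun j hj => ?_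
      cases j with
      | zero => simp [consStr, hU₀]
      | succ j =>
        rw [hU₀, if_neg (by omega), if_neg (by omega), if_pos (by omega)]
        exact congrArg S (by omega)
  · intro U hA hB j hj
    rw [ampMat_prefixStr] at hA
    rw [insertMat_prefixStr] at hB
    split_ifs at hA hB with hA' hB'
    · have hne : U a ≠ U (a + 1) := fun he => hB (by rw [he, hw])
      have h2 := hA' j hj
      have h3 := hA' a (by omega) (by omega)
      have h4 := hB' (j - 2)
      rw [hU₀]
      split_ifs with c1 c2 c3
      · exact (h2 (by omega)).symm
      · subst c2
        omega
      · rw [h4 (by omega), if_neg (by omega)]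
        congr 1
        omega
      · exact (h2 (by omega)).symm
    all_goals contradiction

lemma ampMat_mul_insertMat_right {w : Fin 2 → Fin 2 → ℂ} (hw : ∀ x, w x x = 0) {n m a d : ℕ}
    (hn : n = m + 2) (h : a + (d + 1) ≤ n) (ha : a + d + 1 < n)
    (M : Matrix (Str (d + 1)) (Str (d + 1)) ℂ) (T S : ℕ → Fin 2) :
    (ampMat n a (d + 1) h M * insertMat w n m (a + d) hn ha) (prefixStr n T) (prefixStr m S) =
      if ∀ j < m, (j < a → S j = T j) ∧ (a + d ≤ j → S j = T (j + 2)) then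
        w (1 - T (a + (d + 1))) (T (a + (d + 1))) * M (prefixStr (d + 1) fun j => T (a + j))
          (prefixStr (d + 1) (Function.update (fun j => S (a + j)) d (1 - T (a + (d + 1)))))
      else 0 := by
  generalize hx : 1 - T (a + (d + 1)) = x
  obtain ⟨U₀, hU₀⟩ : ∃ U₀ : ℕ → Fin 2, ∀ j, U₀ j = if j < a then T j else if j < a + d then S j else
    if j = a + d then x else T j := ⟨_, fun _ => rfl⟩
  rw [mul_apply_eq_of_unique _ _ _ _ U₀]
  · rw [ampMat_prefixStr, insertMat_prefixStr, if_pos (fun j hj hj' => by grind -ring), mul_comm]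
    have hcond : (∀ j < m, (j < a → S j = T j) ∧ (a + d ≤ j → S j = T (j + 2))) ↔
        ∀ j < m, S j = U₀ (if j < a + d then j else j + 2) :=
      forall₂_congr fun j hj => by grind -ring
    rw [← if_congr hcond rfl rfl, ite_mul, zero_mul, show U₀ (a + d) = x by grind -ring,
      show U₀ (a + d + 1) = T (a + (d + 1)) by grind -ring]
    congr 3
    exact prefixStr_congr fun j hj => by grind -ring [Function.update_apply]
  · intro U hA hB j hj
    rw [ampMat_prefixStr] at hA
    rw [insertMat_prefixStr] at hB
    split_ifs at hA hB with hA' hB'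
    · have hne : U (a + d) ≠ U (a + d + 1) := fun he => hB (by rw [he, hw])
      have h2 := hA' j hj
      have h3 := hA' (a + (d + 1)) (by omega) (by omega)
      have h4 := hB' j
      rw [hU₀]
      split_ifs with c1 c2 c3
      · exact (h2 (by omega)).symm
      · rw [h4 (by omega), if_pos (by omega)]
      · subst c3
        rw [← add_assoc] at h3 hx
        omega
      · exact (h2 (by omega)).symm
    all_goals contradiction

/-- A relation between the two ways of inserting a vector of `V ⊗ V` next to a matrix `M` acting on
`d + 1` factors carries over to any number of strands. -/
lemma ampMat_mul_insertMat {w : Fin 2 → Fin 2 → ℂ} (hw : ∀ x, w x x = 0) {n m a b c d : ℕ}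
    (hcd : c = d + 1) (hb : b = a + d) (hn : n = m + 2) (h : a + 1 + c ≤ n) (h' : a + c ≤ n)
    (ha : a + 1 < n) (hb' : b + 1 < n) (M : Matrix (Str c) (Str c) ℂ)
    (hM : ∀ T S : ℕ → Fin 2,
      w (T 0) (1 - T 0) *
          M (prefixStr c fun j => T (j + 1)) (prefixStr c (consStr (1 - T 0) S)) =
        w (1 - T (d + 1)) (T (d + 1)) *
          M (prefixStr c T) (prefixStr c (Function.update S d (1 - T (d + 1))))) :
    ampMat n (a + 1) c h M * insertMat w n m a hn ha =
      ampMat n a c h' M * insertMat w n m b hn hb' := by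
  subst hcd hb
  ext t s
  obtain ⟨T, rfl⟩ := prefixStr_surjective n t
  obtain ⟨S, rfl⟩ := prefixStr_surjective m s
  rw [ampMat_mul_insertMat_left hw, ampMat_mul_insertMat_right hw]
  exact if_congr Iff.rfl (hM (fun j => T (a + j)) fun j => S (a + j)) rfl

lemma capMat_eq_insertMat (q : ℂ) {N M i : ℕ} (h : N = M + 2) (hi : i + 1 < N) :
    capMat q N M i h hi = insertMat (fun x y => if x = 1 ∧ y = 0 then q⁻¹ else
      if x = 0 ∧ y = 1 then -1 else 0) N M i h hi :=
  rfl

lemma cupMat_eq_insertMat (q : ℂ) {N M i : ℕ} (h : N = M + 2) (hi : i + 1 < N) :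
    cupMat q N M i h hi = (insertMat (fun x y => if x = 1 ∧ y = 0 then 1 else
      if x = 0 ∧ y = 1 then -q else 0) N M i h hi).transpose :=
  rfl

lemma IsPosMatrix.ampMat_mul_capMat {q : ℂ} (hq : q ≠ 0) {n m a b c d : ℕ} {P : ℤ} {C : ℤ → ℂ}
    {M : Matrix (Str c) (Str c) ℂ} (hM : IsPosMatrix q c P C M) (hcd : c = d + 1)
    (hP : q ^ P = -1) (hd : q ^ ((d : ℤ) + 2) = 1) (hC : AlternatesOn c P C)
    (hb : b = a + d) (hn : n = m + 2) (h : a + 1 + c ≤ n) (h' : a + c ≤ n)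
    (ha : a + 1 < n) (hb' : b + 1 < n) :
    ampMat n (a + 1) c h M * capMat q n m a hn ha =
      ampMat n a c h' M * capMat q n m b hn hb' := by
  subst hcd
  rw [capMat_eq_insertMat, capMat_eq_insertMat]
  refine ampMat_mul_insertMat (by grind -ring) rfl hb _ _ _ _ _ _ fun T S => ?_
  convert hM.cap_slide hq hP hd hC T S using 2
  · generalize T 0 = x
    fin_cases x <;> simp
  · generalize T (d + 1) = x
    fin_cases x <;> simp

lemma IsPosMatrix.cupMat_mul_ampMat {q : ℂ} (hq : q ≠ 0) {n m a b c d : ℕ} {P : ℤ} {C : ℤ → ℂ}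
    {M : Matrix (Str c) (Str c) ℂ} (hM : IsPosMatrix q c P C M) (hcd : c = d + 1)
    (hP : q ^ P = -1) (hd : q ^ ((d : ℤ) + 2) = 1) (hC : AlternatesOn c P C)
    (hb : b = a + d) (hn : n = m + 2) (h : a + 1 + c ≤ n) (h' : a + c ≤ n)
    (ha : a + 1 < n) (hb' : b + 1 < n) :
    cupMat q n m a hn ha * ampMat n (a + 1) c h M =
      cupMat q n m b hn hb' * ampMat n a c h' M := by
  subst hcd
  rw [← Matrix.transpose_inj, Matrix.transpose_mul, Matrix.transpose_mul, ampMat_transpose,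
    ampMat_transpose, cupMat_eq_insertMat, cupMat_eq_insertMat, Matrix.transpose_transpose,
    Matrix.transpose_transpose]
  refine ampMat_mul_insertMat (by grind -ring) rfl hb _ _ _ _ _ _ fun S T => ?_
  simp only [Matrix.transpose_apply]
  convert hM.cup_slide hq hP hd hC T S using 2
  · generalize S 0 = x
    fin_cases x <;> simp
  · generalize S (d + 1) = x
    fin_cases x <;> simp

lemma qfact_succ (q : ℂ) (n : ℕ) : qfact q (n + 1) = qfact q n * qint q ((n : ℤ) + 1) :=
  Finset.prod_range_succ _ _

lemma qint_eq_of_add_eq {q : ℂ} (hq : q ≠ 0) {P a b : ℤ} (hP : q ^ P = -1) (hab : a + b = P) :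
    qint q a = qint q b := by
  obtain rfl : a = P - b := by omega
  rw [qint, qint, neg_sub, zpow_sub₀ hq, zpow_sub₀ hq, hP, zpow_neg]
  congr 1
  field_simp
  ring

lemma geom_sum_sq_eq_qint {q : ℂ} (hq : q ≠ 0) (hq2 : q ^ 2 ≠ 1) (m : ℕ) :
    ∑ r ∈ Finset.range (m + 1), (q ^ 2) ^ r = q ^ m * qint q ((m : ℤ) + 1) := by
  have h1 : q ^ 2 - 1 ≠ 0 := sub_ne_zero.2 hq2
  rw [geom_sum_eq hq2, qint]
  have h2 : q - q⁻¹ ≠ 0 := by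
    intro h
    apply h1
    field_simp at h
    simpa using h
  have h3 : q ^ (-((m : ℤ) + 1)) = (q ^ (m + 1))⁻¹ := by
    rw [zpow_neg]
    norm_cast
  have h4 : q ^ ((m : ℤ) + 1) = q ^ (m + 1) := by norm_cast
  rw [h3, h4]
  field_simp
  ring

lemma sum_pow_card_filter_lt {ι : Type*} [LinearOrder ι] (x : ℂ) (S : Finset ι) :
    ∑ i ∈ S, x ^ (S.filter (i < ·)).card = ∑ r ∈ Finset.range S.card, x ^ r := by
  induction S using Finset.induction_on_min with
  | empty => simp
  | insert a s ha ih =>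
    have has : a ∉ s := fun h => (ha a h).false
    rw [Finset.sum_insert has, Finset.card_insert_of_notMem has, Finset.sum_range_succ, ← ih,
      add_comm]
    congr 1
    · refine Finset.sum_congr rfl fun i hi => ?_
      rw [Finset.filter_insert, if_neg (ha i hi).not_gt]
    · rw [Finset.filter_insert, if_neg (lt_irrefl a), Finset.filter_true_of_mem ha]

lemma sum_pow_card_filter_gt {ι : Type*} [LinearOrder ι] (x : ℂ) (S : Finset ι) :
    ∑ i ∈ S, x ^ (S.filter (· < i)).card = ∑ r ∈ Finset.range S.card, x ^ r :=
  sum_pow_card_filter_lt (ι := ιᵒᵈ) x S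

/-- A sequence of functions of finite sets obtained by successively adding elements, where an
element `i` carries a weight `q ^ (w i + 2 * cnt S i)` such that `∑ i ∈ S, q ^ (2 * cnt S i)` is a
geometric sum, is given by quantum factorials. -/
lemma eq_qfact_of_erase_recursion {ι : Type*} [DecidableEq ι] {q : ℂ} (hq : q ≠ 0)
    (hq2 : q ^ 2 ≠ 1) (v : ℕ → Finset ι → ℂ) (w : ι → ℤ) (cnt : Finset ι → ι → ℕ)
    (h0 : ∀ S, v 0 S = if S = ∅ then 1 else 0)
    (hv : ∀ m S, v (m + 1) S = ∑ i ∈ S, q ^ (w i + 2 * (cnt S i : ℤ)) * v m (S.erase i))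
    (hcnt : ∀ S, ∑ i ∈ S, (q ^ 2) ^ cnt S i = ∑ r ∈ Finset.range S.card, (q ^ 2) ^ r)
    (m : ℕ) (S : Finset ι) :
    v m S = if S.card = m then qfact q m * q ^ (∑ i ∈ S, w i + (m.choose 2 : ℤ)) else 0 := by
  induction m generalizing S with
  | zero =>
    rw [h0]
    by_cases hS : S = ∅ <;> simp [hS, qfact]
  | succ m ih =>
    rw [hv]
    split_ifs with hS
    · have hterm : ∀ i ∈ S, q ^ (w i + 2 * (cnt S i : ℤ)) * v m (S.erase i) =
          qfact q m * q ^ (∑ i ∈ S, w i + (m.choose 2 : ℤ)) * (q ^ 2) ^ cnt S i := by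
        intro i hi
        rw [ih, if_pos (by rw [Finset.card_erase_of_mem hi, hS, Nat.add_sub_cancel]),
          ← Finset.add_sum_erase S w hi, mul_left_comm, ← zpow_add₀ hq, mul_assoc, ← pow_mul,
          ← zpow_natCast, ← zpow_add₀ hq]
        congr 2
        push_cast
        ring
      rw [Finset.sum_congr rfl hterm, ← Finset.mul_sum, hcnt, hS, geom_sum_sq_eq_qint hq hq2,
        qfact_succ, Nat.choose_succ_succ', Nat.choose_one_right]
      push_cast
      rw [show ∑ i ∈ S, w i + ((m : ℤ) + (m.choose 2 : ℤ)) =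
        ∑ i ∈ S, w i + (m.choose 2 : ℤ) + m by ring, zpow_add₀ hq _ (m : ℤ), zpow_natCast]
      ring
    · refine Finset.sum_eq_zero fun i hi => ?_
      rw [ih, if_neg, mul_zero]
      intro h
      have := Finset.card_erase_add_one hi
      omega

/-- The string with value `y` on `S` and value `x` elsewhere. -/
def indStr {z : ℕ} (x y : Fin 2) (S : Finset (Fin z)) : Str z := fun j => if j ∈ S then y else x

lemma indStr_eq_indStr_iff {z : ℕ} {x y : Fin 2} (hxy : x ≠ y) {S S' : Finset (Fin z)} :
    indStr x y S = indStr x y S' ↔ S = S' := by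
  refine ⟨fun h => ?_, fun h => h ▸ rfl⟩
  ext j
  have := congrFun h j
  simp only [indStr] at this
  split_ifs at this with h1 h2 h2 <;> simp_all

lemma flip_mulVec {z : ℕ} {x y : Fin 2} (hxy : x ≠ y) (e : Fin z → Str z → ℂ) (v : Vz z)
    (S : Finset (Fin z)) :
    Matrix.mulVec (fun t s => ∑ i : Fin z, if s i = x ∧ t = Function.update s i y then
        e i s else 0) v (indStr x y S) =
      ∑ i ∈ S, e i (indStr x y (S.erase i)) * v (indStr x y (S.erase i)) := by
  simp only [Matrix.mulVec, dotProduct, Finset.sum_mul]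
  rw [Finset.sum_comm, ← Finset.sum_subset (Finset.subset_univ S)]
  · refine Finset.sum_congr rfl fun i hi => ?_
    rw [Finset.sum_eq_single (indStr x y (S.erase i)), if_pos]
    · refine ⟨by simp [indStr], ?_⟩
      ext j
      by_cases hj : j = i
      · subst hj
        simp [indStr, hi]
      · simp [indStr, hj]
    · intro s _ hs
      rw [if_neg, zero_mul]
      rintro ⟨h1, h2⟩
      apply hs
      ext j
      by_cases hj : j = i
      · subst hj
        simp [indStr, h1]
      · have := congrFun h2 j
        rw [Function.update_of_ne hj] at this
        simp [← this, indStr, hj]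
    · simp
  · intro i _ hi
    refine Finset.sum_eq_zero fun s _ => ?_
    rw [if_neg, zero_mul]
    rintro ⟨-, h2⟩
    have := congrFun h2 i
    simp [indStr, hi, hxy] at this

lemma sum_kwt_indStr {z : ℕ} (x y : Fin 2) (S J : Finset (Fin z)) :
    ∑ j ∈ J, kwt (indStr x y S j) =
      kwt x * J.card + (kwt y - kwt x) * (J.filter (· ∈ S)).card := by
  rw [Finset.card_filter, Finset.card_eq_sum_ones, Nat.cast_sum, Nat.cast_sum, Finset.mul_sum,
    Finset.mul_sum, ← Finset.sum_add_distrib]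
  refine Finset.sum_congr rfl fun j _ => ?_
  by_cases hj : j ∈ S <;> simp [indStr, hj]

lemma EOp_pow_xtop {q : ℂ} (hq : q ≠ 0) (hq2 : q ^ 2 ≠ 1) (z m : ℕ) (S : Finset (Fin z)) :
    (EOp q z ^ m) (xtop z) (indStr 1 0 S) = if S.card = m then
      qfact q m * q ^ (∑ i ∈ S, (((i : ℕ) : ℤ) + 1 - z) + (m.choose 2 : ℤ)) else 0 := by
  refine eq_qfact_of_erase_recursion hq hq2 (fun m S => (EOp q z ^ m) (xtop z) (indStr 1 0 S))
    (fun i => ((i : ℕ) : ℤ) + 1 - z) (fun S i => (S.filter (i < ·)).card) (fun S => ?_)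
    (fun m S => ?_) (sum_pow_card_filter_lt (q ^ 2)) m S
  · have : (fun j => if j ∈ (Finset.univ : Finset (Fin z)) then 1 else 0 : Str z) =
      indStr 1 0 ∅ := by ext j; simp [indStr]
    rw [pow_zero, Module.End.one_apply, xtop, rho, this]
    simp only [indStr_eq_indStr_iff one_ne_zero]
  · simp only [pow_succ', Module.End.mul_apply]
    rw [EOp, Matrix.mulVecLin_apply]
    refine (flip_mulVec one_ne_zero _ _ S).trans (Finset.sum_congr rfl fun i hi => ?_)
    rw [sum_kwt_indStr]
    congr 2
    have h1 : (Finset.univ.filter (i < ·)).card = z - 1 - i := by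
      rw [← Fin.card_Ioi]
      congr 1
      ext j
      simp
    have h2 : (Finset.univ.filter (i < ·)).filter (· ∈ S.erase i) = S.filter (i < ·) := by
      ext j
      simp only [Finset.mem_filter, Finset.mem_erase, Finset.mem_univ, true_and]
      exact ⟨fun h => ⟨h.2.2, h.1⟩, fun h => ⟨h.2, h.2.ne', h.1⟩⟩
    rw [h1, h2]
    have := i.isLt
    simp [kwt]
    omega

lemma FOp_pow_x0 {q : ℂ} (hq : q ≠ 0) (hq2 : q ^ 2 ≠ 1) (z m : ℕ) (S : Finset (Fin z)) :
    (FOp q z ^ m) (x0 z) (indStr 0 1 S) = if S.card = m then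
      qfact q m * q ^ (∑ i ∈ S, (-((i : ℕ) : ℤ)) + (m.choose 2 : ℤ)) else 0 := by
  refine eq_qfact_of_erase_recursion hq hq2 (fun m S => (FOp q z ^ m) (x0 z) (indStr 0 1 S))
    (fun i => -((i : ℕ) : ℤ)) (fun S i => (S.filter (· < i)).card) (fun S => ?_)
    (fun m S => ?_) (sum_pow_card_filter_gt (q ^ 2)) m S
  · have : (fun j => if j ∈ (∅ : Finset (Fin z)) then 1 else 0 : Str z) =
      indStr 0 1 ∅ := rfl
    rw [pow_zero, Module.End.one_apply, x0, rho, this]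
    simp only [indStr_eq_indStr_iff zero_ne_one]
  · simp only [pow_succ', Module.End.mul_apply]
    rw [FOp, Matrix.mulVecLin_apply]
    refine (flip_mulVec zero_ne_one _ _ S).trans (Finset.sum_congr rfl fun i hi => ?_)
    rw [sum_kwt_indStr]
    congr 2
    have h1 : (Finset.univ.filter (· < i)).card = i := by
      rw [← Fin.card_Iio]
      congr 1
      ext j
      simp
    have h2 : (Finset.univ.filter (· < i)).filter (· ∈ S.erase i) = S.filter (· < i) := by
      ext j
      simp only [Finset.mem_filter, Finset.mem_erase, Finset.mem_univ, true_and]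
      exact ⟨fun h => ⟨h.2.2, h.1⟩, fun h => ⟨h.2, h.2.ne, h.1⟩⟩
    rw [h1, h2]
    simp [kwt]
    ring

lemma sum_onesOf_prefixStr (c : ℕ) (T : ℕ → Fin 2) (f : ℕ → ℤ) :
    ∑ j ∈ onesOf (prefixStr c T), f j = ∑ j ∈ Finset.range c, f j * ((T j : ℕ) : ℤ) := by
  rw [onesOf, Finset.sum_filter, ← Fin.sum_univ_eq_sum_range (fun j => f j * ((T j : ℕ) : ℤ))]
  refine Finset.sum_congr rfl fun j _ => ?_
  obtain h | h : T j = 0 ∨ T j = 1 := by omega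
  all_goals simp [prefixStr, h]

lemma card_onesOf_prefixStr (c : ℕ) (T : ℕ → Fin 2) :
    ((onesOf (prefixStr c T)).card : ℤ) = onesCount c T := by
  rw [Finset.card_eq_sum_ones, Nat.cast_sum]
  simpa [onesCount] using sum_onesOf_prefixStr c T fun _ => 1

lemma posSum_onesOf_prefixStr (c : ℕ) (T : ℕ → Fin 2) :
    posSum (onesOf (prefixStr c T)) = onesPos c T :=
  sum_onesOf_prefixStr c T fun j => (j : ℤ) + 1

lemma indStr_onesOf {z : ℕ} (t : Str z) : indStr 0 1 (onesOf t) = t := by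
  ext j
  obtain h | h : t j = 0 ∨ t j = 1 := by omega
  all_goals simp [indStr, onesOf, h]

lemma indStr_compl_onesOf {z : ℕ} (t : Str z) : indStr 1 0 (onesOf t)ᶜ = t := by
  ext j
  obtain h | h : t j = 0 ∨ t j = 1 := by omega
  all_goals simp [indStr, onesOf, h]

/-- The coefficients of the matrix of `α` in the sense of `IsPosMatrix`. -/
def alphaCoeff (q : ℂ) (p : ℕ) (k : ℤ) : ℂ :=
  qfact q k.toNat * qfact q (p - 1 - k).toNat *
    q ^ ((2 * k + p) * (2 * p - 1) - (k ^ 2 - k) / 2 +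
      ∑ i : Fin (2 * p - 1), (((i : ℕ) : ℤ) + 1 - ((2 * p - 1 : ℕ) : ℤ)) +
      ((p - 1 - k).toNat.choose 2 : ℤ))

/-- The coefficients of the matrix of `β` in the sense of `IsPosMatrix`. -/
def betaCoeff (q : ℂ) (p : ℕ) (k : ℤ) : ℂ :=
  qfact q (2 * p - 1 - k).toNat * qfact q (k - p).toNat *
    q ^ (k * (2 * p - 1) - (k ^ 2 - k) / 2 + (k - p) + ((k - p).toNat.choose 2 : ℤ))

lemma zpow_mul_mul_mul_zpow {q : ℂ} (hq : q ≠ 0) (x y : ℂ) {a b c d : ℤ} (h : a + b = c + d) :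
    q ^ a * x * (y * q ^ b) = x * y * q ^ c * q ^ d := by
  rw [mul_assoc (x * y), ← zpow_add₀ hq, ← h, zpow_add₀ hq]
  ring

lemma isPosMatrix_alphaMat {q : ℂ} (hq : q ≠ 0) (hq2 : q ^ 2 ≠ 1) {p : ℕ} (hp : 0 < p) :
    IsPosMatrix q (2 * p - 1) p (alphaCoeff q p) (alphaMat q p) := by
  intro T S
  have hT := card_onesOf_prefixStr (2 * p - 1) T
  have hS := card_onesOf_prefixStr (2 * p - 1) S
  have hTle := onesCount_le (2 * p - 1) T
  rw [← posSum_onesOf_prefixStr, ← posSum_onesOf_prefixStr, ← hT, ← hS]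
  rw [← hT] at hTle
  generalize prefixStr (2 * p - 1) T = t at *
  generalize prefixStr (2 * p - 1) S = s at *
  simp only [alphaMat]
  have hsum := Finset.sum_add_sum_compl (onesOf t)
    fun i => (((i : ℕ) : ℤ) + 1 - ((2 * p - 1 : ℕ) : ℤ))
  have hpos : ∑ i ∈ onesOf t, (((i : ℕ) : ℤ) + 1 - ((2 * p - 1 : ℕ) : ℤ)) =
      posSum (onesOf t) - (onesOf t).card * ((2 * p - 1 : ℕ) : ℤ) := by
    rw [Finset.sum_sub_distrib, posSum]
    simp
  have hcard := Finset.card_compl_add_card (onesOf t)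
  rw [Fintype.card_fin] at hcard
  have hE := EOp_pow_xtop hq hq2 (2 * p - 1) (p - 1 - (onesOf s).card) (onesOf t)ᶜ
  rw [indStr_compl_onesOf] at hE
  rw [hE]
  generalize (onesOf s).card = k at *
  by_cases hk : k < p
  · rw [if_pos hk]
    by_cases hc : ((onesOf t).card : ℤ) = k + p
    · rw [if_pos hc, if_pos (by omega), alphaCoeff,
        show ((p : ℤ) - 1 - k).toNat = p - 1 - k by omega, Int.toNat_natCast]
      refine zpow_mul_mul_mul_zpow hq _ _ ?_
      have hz : ((2 * p - 1 : ℕ) : ℤ) = 2 * p - 1 := by omega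
      rw [hc] at hpos
      linear_combination hsum - hpos + (2 * (k : ℤ) + p) * hz
    · rw [if_neg hc, if_neg (by omega), mul_zero]
  · rw [if_neg hk, if_neg (by omega)]

lemma isPosMatrix_betaMat {q : ℂ} (hq : q ≠ 0) (hq2 : q ^ 2 ≠ 1) {p : ℕ} (hp : 0 < p) :
    IsPosMatrix q (2 * p - 1) (-p) (betaCoeff q p) (betaMat q p) := by
  intro T S
  have hT := card_onesOf_prefixStr (2 * p - 1) T
  have hS := card_onesOf_prefixStr (2 * p - 1) S
  have hSle := onesCount_le (2 * p - 1) S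
  rw [← posSum_onesOf_prefixStr, ← posSum_onesOf_prefixStr, ← hT, ← hS]
  rw [← hS] at hSle
  generalize prefixStr (2 * p - 1) T = t at *
  generalize prefixStr (2 * p - 1) S = s at *
  simp only [betaMat]
  have hpos : ∑ i ∈ onesOf t, (-((i : ℕ) : ℤ)) = (onesOf t).card - posSum (onesOf t) := by
    rw [posSum, Finset.sum_add_distrib, Finset.sum_neg_distrib]
    simp
  have hF := FOp_pow_x0 hq hq2 (2 * p - 1) ((onesOf s).card - p) (onesOf t)
  rw [indStr_onesOf] at hF
  rw [hF]
  generalize (onesOf s).card = k at *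
  by_cases hk : p ≤ k
  · rw [if_pos hk]
    by_cases hc : ((onesOf t).card : ℤ) = k + -p
    · rw [if_pos hc, if_pos (by omega), betaCoeff, show ((k : ℤ) - p).toNat = k - p by omega,
        show (2 * (p : ℤ) - 1 - k).toNat = 2 * p - 1 - k by omega]
      refine zpow_mul_mul_mul_zpow hq _ _ ?_
      have hz : ((2 * p - 1 : ℕ) : ℤ) = 2 * p - 1 := by omega
      linear_combination hpos + hc + (k : ℤ) * hz
    · rw [if_neg hc, if_neg (by omega), mul_zero]
  · rw [if_neg hk, if_neg (by omega)]

lemma add_one_sq_sub_ediv_two (k : ℤ) :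
    ((k + 1) ^ 2 - (k + 1)) / 2 = (k ^ 2 - k) / 2 + k := by
  rw [← Int.add_mul_ediv_right _ _ two_ne_zero]
  congr 1
  ring

lemma alternatesOn_alphaCoeff {q : ℂ} (hq : q ≠ 0) {p : ℕ} (hP : q ^ (p : ℤ) = -1) :
    AlternatesOn (2 * p - 1) p (alphaCoeff q p) := by
  intro k hk0 _ _ hk
  lift k to ℕ using hk0
  obtain ⟨m, rfl⟩ : ∃ m, p = k + m + 2 := ⟨p - k - 2, by omega⟩
  simp only [alphaCoeff, add_one_sq_sub_ediv_two]
  generalize ∑ i : Fin (2 * (k + m + 2) - 1), (((i : ℕ) : ℤ) + 1 - _) = A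
  rw [show ((k : ℤ) + 1).toNat = k + 1 by omega, Int.toNat_natCast,
    show (((k + m + 2 : ℕ) : ℤ) - 1 - (k + 1)).toNat = m by omega,
    show (((k + m + 2 : ℕ) : ℤ) - 1 - k).toNat = m + 1 by omega, qfact_succ, qfact_succ,
    qint_eq_of_add_eq hq hP (a := (k : ℤ) + 1) (b := (m : ℤ) + 1) (by push_cast; ring),
    Nat.choose_succ_succ', Nat.choose_one_right]
  generalize ((k : ℤ) ^ 2 - k) / 2 = B
  push_cast at hP ⊢
  rw [show (2 * ((k : ℤ) + 1) + (k + m + 2)) * (2 * (k + m + 2) - 1) - (B + k) + A +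
        (m.choose 2 : ℤ) =
      ((2 * (k : ℤ) + (k + m + 2)) * (2 * (k + m + 2) - 1) - B + A + (m + (m.choose 2 : ℤ))) +
        (k + m + 2) * 3 by ring, zpow_add₀ hq, zpow_mul q _ 3, hP]
  have : (-1 : ℂ) ^ (3 : ℤ) = -1 := by norm_num [zpow_ofNat]
  rw [this]
  ring

lemma alternatesOn_betaCoeff {q : ℂ} (hq : q ≠ 0) {p : ℕ} (hP : q ^ (p : ℤ) = -1) :
    AlternatesOn (2 * p - 1) (-p) (betaCoeff q p) := by
  intro k hk0 hk hk1 _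
  lift k to ℕ using hk0
  obtain ⟨m, rfl⟩ : ∃ m, k = p + m := ⟨k - p, by omega⟩
  obtain ⟨l, rfl⟩ : ∃ l, p = m + l + 2 := ⟨p - m - 2, by omega⟩
  simp only [betaCoeff, add_one_sq_sub_ediv_two]
  generalize (((m + l + 2 + m : ℕ) : ℤ) ^ 2 - ((m + l + 2 + m : ℕ) : ℤ)) / 2 = B
  rw [show (2 * ((m + l + 2 : ℕ) : ℤ) - 1 - ((m + l + 2 + m : ℕ) + 1)).toNat = l by omega,
    show (2 * ((m + l + 2 : ℕ) : ℤ) - 1 - (m + l + 2 + m : ℕ)).toNat = l + 1 by omega,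
    show (((m + l + 2 + m : ℕ) : ℤ) + 1 - (m + l + 2 : ℕ)).toNat = m + 1 by omega,
    show (((m + l + 2 + m : ℕ) : ℤ) - (m + l + 2 : ℕ)).toNat = m by omega, qfact_succ, qfact_succ,
    qint_eq_of_add_eq hq hP (a := (l : ℤ) + 1) (b := (m : ℤ) + 1) (by push_cast; ring),
    Nat.choose_succ_succ', Nat.choose_one_right]
  push_cast at hP ⊢
  rw [show ((m : ℤ) + l + 2 + m + 1) * (2 * (m + l + 2) - 1) - (B + (m + l + 2 + m)) +
        (m + l + 2 + m + 1 - (m + l + 2)) + (m + (m.choose 2 : ℤ)) =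
      ((m + l + 2 + m) * (2 * (m + l + 2) - 1) - B + (m + l + 2 + m - (m + l + 2)) +
        (m.choose 2 : ℤ)) + (m + l + 2) by ring, zpow_add₀ hq _ ((m : ℤ) + l + 2), hP]
  ring

lemma exp_pi_mul_I_div_facts {p : ℕ} (hp : 2 ≤ p) {q : ℂ}
    (hq : q = Complex.exp (Real.pi * Complex.I / p)) :
    q ≠ 0 ∧ q ^ (p : ℤ) = -1 ∧ q ^ 2 ≠ 1 := by
  have hp0 : (p : ℂ) ≠ 0 := by
    norm_cast
    omega
  refine ⟨hq ▸ Complex.exp_ne_zero _, ?_, ?_⟩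
  · rw [hq, zpow_natCast, ← Complex.exp_nat_mul, mul_div_cancel₀ _ hp0, Complex.exp_pi_mul_I]
  · have h := Complex.isPrimitiveRoot_exp (2 * p) (by omega)
    have h2 : q = Complex.exp (2 * Real.pi * Complex.I / ((2 * p : ℕ) : ℂ)) := by
      rw [hq]
      congr 1
      push_cast
      field_simp
    rw [← h2] at h
    exact h.pow_ne_one_of_pos_of_lt two_ne_zero (by omega)

/-- for `n ≥ 2p` and `1 ≤ i ≤ n - 2p + 1` (written `i + 2p ≤ n + 1`),
`α_{i+1}∘∩ᵢ = αᵢ∘∩_{i+2p-2}` and `β_{i+1}∘∩ᵢ = βᵢ∘∩_{i+2p-2}` as maps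
`V^{⊗(n-2)} → V^{⊗n}`, and `∪ᵢ∘α_{i+1} = ∪_{i+2p-2}∘αᵢ`, `∪ᵢ∘β_{i+1} = ∪_{i+2p-2}∘βᵢ`
as maps `V^{⊗n} → V^{⊗(n-2)}` (cup/cap positions are passed 0-indexed). -/
theorem stmt5 (p : ℕ) (hp : 2 ≤ p) (q : ℂ)
    (hq : q = Complex.exp (Real.pi * Complex.I / p))
    (n : ℕ) (hn : 2 * p ≤ n)
    (i : ℕ) (hi1 : 1 ≤ i) (hi2 : i + 2 * p ≤ n + 1) :
    alphaOpAt q p n (i + 1) (by omega) ∘ₗ capOp q n (n - 2) (i - 1) (by omega) (by omega)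
        = alphaOpAt q p n i (by omega) ∘ₗ
            capOp q n (n - 2) (i + 2 * p - 3) (by omega) (by omega) ∧
      betaOpAt q p n (i + 1) (by omega) ∘ₗ capOp q n (n - 2) (i - 1) (by omega) (by omega)
        = betaOpAt q p n i (by omega) ∘ₗ
            capOp q n (n - 2) (i + 2 * p - 3) (by omega) (by omega) ∧
      cupOp q n (n - 2) (i - 1) (by omega) (by omega) ∘ₗ alphaOpAt q p n (i + 1) (by omega)
        = cupOp q n (n - 2) (i + 2 * p - 3) (by omega) (by omega) ∘ₗ
            alphaOpAt q p n i (by omega) ∧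
      cupOp q n (n - 2) (i - 1) (by omega) (by omega) ∘ₗ betaOpAt q p n (i + 1) (by omega)
        = cupOp q n (n - 2) (i + 2 * p - 3) (by omega) (by omega) ∘ₗ
            betaOpAt q p n i (by omega) := by
  obtain ⟨a, rfl⟩ : ∃ a, i = a + 1 := ⟨i - 1, by omega⟩
  obtain ⟨hq0, hqp, hq2⟩ := exp_pi_mul_I_div_facts hp hq
  have hd : q ^ (((2 * p - 2 : ℕ) : ℤ) + 2) = 1 := by
    rw [show ((2 * p - 2 : ℕ) : ℤ) + 2 = (p : ℤ) + p by omega, zpow_add₀ hq0, hqp]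
    norm_num
  have hqn : q ^ (-(p : ℤ)) = -1 := by
    rw [zpow_neg, hqp]
    norm_num
  have hα := isPosMatrix_alphaMat hq0 hq2 (by omega : 0 < p)
  have hβ := isPosMatrix_betaMat hq0 hq2 (by omega : 0 < p)
  have hαC := alternatesOn_alphaCoeff hq0 hqp
  have hβC := alternatesOn_betaCoeff hq0 hqp
  simp only [alphaOpAt, betaOpAt, capOp, cupOp, ← Matrix.mulVecLin_mul]
  refine ⟨congrArg _ ?_, congrArg _ ?_, congrArg _ ?_, congrArg _ ?_⟩
  · exact hα.ampMat_mul_capMat hq0 (by omega) hqp hd hαC (by omega) _ _ _ _ _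
  · exact hβ.ampMat_mul_capMat hq0 (by omega) hqn hd hβC (by omega) _ _ _ _ _
  · exact hα.cupMat_mul_ampMat hq0 (by omega) hqp hd hαC (by omega) _ _ _ _ _
  · exact hβ.cupMat_mul_ampMat hq0 (by omega) hqn hd hβC (by omega) _ _ _ _ _

end
end

section
/- For every z ≥ 1 and 0 ≤ k ≤ z, F_z^k x_{0,z} = Σ_{1 ≤ i₁ < ⋯ < i_k ≤ z} q^{(k²+k)/2 − (i₁+⋯+i_k)}·([k]!)·ρ_{i₁,…,i_k,z}. -/
noncomputable section

/-- Summing a function of the rank over a finite subset of a linear order. -/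
theorem sum_card_filter_lt {α M : Type*} [LinearOrder α] [AddCommMonoid M] (g : ℕ → M)
    (T : Finset α) :
    ∑ i ∈ T, g (T.filter (fun j => j < i)).card = ∑ r ∈ Finset.range T.card, g r := by
  induction T using Finset.induction_on_max with
  | empty => simp
  | insert a s hs ih =>
    have ha : a ∉ s := fun h => lt_irrefl a (hs a h)
    rw [Finset.sum_insert ha, Finset.card_insert_of_notMem ha, Finset.sum_range_succ, ← ih,
      add_comm]
    congr 1
    · refine Finset.sum_congr rfl fun i hi => ?_
      rw [Finset.filter_insert, if_neg (hs i hi).asymm]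
    · rw [Finset.filter_insert, if_neg (lt_irrefl a), Finset.filter_true_of_mem hs]

theorem sum_zpow_two_mul (q : ℂ) (hq0 : q ≠ 0) (hq1 : q ^ 2 ≠ 1) (k : ℕ) :
    ∑ r ∈ Finset.range (k + 1), q ^ (2 * (r : ℤ)) = q ^ (k : ℤ) * qint q ((k : ℤ) + 1) := by
  have h1 : q ^ 2 - 1 ≠ 0 := sub_ne_zero.mpr hq1
  have hg : ∑ r ∈ Finset.range (k + 1), q ^ (2 * (r : ℤ))
      = ∑ r ∈ Finset.range (k + 1), (q ^ 2) ^ r := by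
    refine Finset.sum_congr rfl fun r _ => ?_
    rw [← pow_mul]
    exact_mod_cast zpow_natCast q (2 * r)
  have h2 : q - q⁻¹ ≠ 0 := by
    intro h
    apply h1
    field_simp at h
    rwa [mul_zero] at h
  rw [hg, geom_sum_eq hq1, qint, ← mul_div_assoc, div_eq_div_iff h1 h2, zpow_neg,
    zpow_add_one₀ hq0, zpow_natCast, ← pow_mul]
  field_simp
  ring

theorem rho_apply {z : ℕ} (S : Finset (Fin z)) (t : Str z) :
    rho z S t = if S = onesOf t then 1 else 0 := by
  unfold rho
  congr 1
  rw [eq_iff_iff]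
  constructor
  · rintro rfl
    ext j
    simp [onesOf]
  · rintro rfl
    ext j
    by_cases h : t j = 1
    · simp [onesOf, h]
    · have : t j = 0 := by omega
      simp [onesOf, this]

theorem onesOf_update_zero {z : ℕ} (t : Str z) (i : Fin z) :
    onesOf (Function.update t i 0) = (onesOf t).erase i := by
  ext j
  by_cases h : j = i
  · subst h
    simp [onesOf]
  · simp [onesOf, h]

theorem sum_kwt_filter_lt {z : ℕ} (t : Str z) (i : Fin z) :
    ∑ j ∈ Finset.univ.filter (fun j => j < i), kwt (t j)
      = ((i : ℕ) : ℤ) - 2 * (((onesOf t).filter (fun j => j < i)).card : ℤ) := by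
  have hk : ∀ j, kwt (t j) = 1 - 2 * (if t j = 1 then 1 else 0) := by
    intro j
    unfold kwt
    by_cases h : t j = 1
    · simp [h]
    · have : t j = 0 := by omega
      simp [this]
  have hs : (onesOf t).filter (fun j => j < i)
      = (Finset.univ.filter (fun j => j < i)).filter (fun j => t j = 1) := by
    ext j
    simp [onesOf, and_comm]
  have hc : (Finset.univ.filter (fun j => j < i)).card = (i : ℕ) := by
    rw [Finset.filter_gt_eq_Iio]
    simp
  rw [Finset.sum_congr rfl fun j _ => hk j, Finset.sum_sub_distrib, ← Finset.mul_sum,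
    Finset.sum_boole, hs]
  simp [hc]

theorem FOp_apply (q : ℂ) (z : ℕ) (f : Vz z) (t : Str z) :
    FOp q z f t = ∑ i ∈ onesOf t,
      q ^ (2 * (((onesOf t).filter (fun j => j < i)).card : ℤ) - ((i : ℕ) : ℤ))
        * f (Function.update t i 0) := by
  have hupd : ∀ (i : Fin z) (s : Str z),
      (s i = 0 ∧ t = Function.update s i 1) ↔ (s = Function.update t i 0 ∧ t i = 1) := by
    intro i s
    constructor
    · rintro ⟨h, rfl⟩
      simp [← h]
    · rintro ⟨rfl, h⟩
      simp [← h]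
  have hsum : ∀ i : Fin z,
      ∑ j ∈ Finset.univ.filter (fun j => j < i), kwt (Function.update t i 0 j)
        = ∑ j ∈ Finset.univ.filter (fun j => j < i), kwt (t j) := by
    intro i
    refine Finset.sum_congr rfl fun j hj => ?_
    rw [Function.update_of_ne (Finset.mem_filter.mp hj).2.ne]
  simp only [FOp, Matrix.mulVecLin_apply, Matrix.mulVec, dotProduct, Fmat, Finset.sum_mul]
  rw [Finset.sum_comm, onesOf, Finset.sum_filter]
  refine Finset.sum_congr rfl fun i _ => ?_
  simp only [hupd, ite_and, ite_mul, zero_mul]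
  rw [Finset.sum_ite_eq' Finset.univ, if_pos (Finset.mem_univ _), hsum, sum_kwt_filter_lt, neg_sub]
  rfl

theorem FOp_pow_x0_apply (q : ℂ) (hq0 : q ≠ 0) (hq1 : q ^ 2 ≠ 1) (z k : ℕ) (t : Str z) :
    (FOp q z ^ k) (x0 z) t = if (onesOf t).card = k then
      q ^ (((k : ℤ) ^ 2 + (k : ℤ)) / 2 - posSum (onesOf t)) * qfact q k else 0 := by
  induction k generalizing t with
  | zero =>
    rw [pow_zero, Module.End.one_apply, x0, rho_apply]
    by_cases h : onesOf t = ∅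
    · simp [h, posSum, qfact]
    · simp [h, Ne.symm h]
  | succ k ih =>
    rw [pow_succ', Module.End.mul_apply, FOp_apply]
    simp only [ih, onesOf_update_zero]
    by_cases h : (onesOf t).card = k + 1
    · have hterm : ∀ i ∈ onesOf t,
          q ^ (2 * (((onesOf t).filter (fun j => j < i)).card : ℤ) - ((i : ℕ) : ℤ))
            * (if ((onesOf t).erase i).card = k then
                q ^ (((k : ℤ) ^ 2 + (k : ℤ)) / 2 - posSum ((onesOf t).erase i)) * qfact q k
              else 0)
          = q ^ (2 * (((onesOf t).filter (fun j => j < i)).card : ℤ))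
            * (q ^ (((k : ℤ) ^ 2 + (k : ℤ)) / 2 + 1 - posSum (onesOf t)) * qfact q k) := by
        intro i hi
        have hp : posSum ((onesOf t).erase i) + (((i : ℕ) : ℤ) + 1) = posSum (onesOf t) :=
          Finset.sum_erase_add _ _ hi
        rw [if_pos (by rw [Finset.card_erase_of_mem hi, h]; rfl), ← mul_assoc, ← mul_assoc,
          ← zpow_add₀ hq0, ← zpow_add₀ hq0, ← hp]
        congr 2
        ring
      have hexp : (((k + 1 : ℕ) : ℤ) ^ 2 + ((k + 1 : ℕ) : ℤ)) / 2
          = ((k : ℤ) ^ 2 + (k : ℤ)) / 2 + 1 + k := by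
        have : ((k + 1 : ℕ) : ℤ) ^ 2 + ((k + 1 : ℕ) : ℤ)
            = (k : ℤ) ^ 2 + (k : ℤ) + 2 * (1 + k) := by push_cast; ring
        omega
      rw [Finset.sum_congr rfl hterm, ← Finset.sum_mul,
        sum_card_filter_lt (fun r : ℕ => q ^ (2 * (r : ℤ))), h,
        sum_zpow_two_mul q hq0 hq1, if_pos rfl, hexp, qfact, qfact, Finset.prod_range_succ,
        show ((k : ℤ) ^ 2 + (k : ℤ)) / 2 + 1 + k - posSum (onesOf t)
          = k + (((k : ℤ) ^ 2 + (k : ℤ)) / 2 + 1 - posSum (onesOf t)) by ring,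
        zpow_add₀ hq0 (k : ℤ)]
      ring
    · rw [if_neg h]
      refine Finset.sum_eq_zero fun i hi => ?_
      have := Finset.card_erase_add_one hi
      rw [if_neg (by omega), mul_zero]

/-- `F_z^k x_{0,z} = Σ_{1 ≤ i₁ < ⋯ < i_k ≤ z} q^{(k²+k)/2 - Σ iⱼ}·[k]!·ρ_{i₁,…,i_k,z}`. -/
theorem stmt15 (q : ℂ) (hq0 : q ≠ 0) (hq1 : q ^ 2 ≠ 1)
    (z : ℕ) (hz : 1 ≤ z) (k : ℕ) (hk : k ≤ z) :
    (FOp q z ^ k) (x0 z)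
      = ∑ S ∈ Finset.powersetCard k (Finset.univ : Finset (Fin z)),
          (q ^ (((k : ℤ) ^ 2 + (k : ℤ)) / 2 - posSum S) * qfact q k) • rho z S := by
  ext t
  rw [FOp_pow_x0_apply q hq0 hq1]
  simp only [Finset.sum_apply, Pi.smul_apply, smul_eq_mul, rho_apply, mul_ite, mul_one, mul_zero,
    Finset.sum_ite_eq', Finset.mem_powersetCard_univ]

end
end
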